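/- The Euler–Lagrange derivative of the free linearized Weyl Lagrangian is the linearized Bach tensor: let n = 4 and let h_{μν}, k_{μν} : ℝ^4 → ℝ be smooth compactly supported symmetric fields. Define the Lagrangian density L[h] = (1/2) 𝒲_{αβγδ}[h] 𝒲^{αβγδ}[h], where 𝒲^{αβγδ} = η^{αα'}η^{ββ'}η^{γγ'}η^{δδ'}𝒲_{α'β'γ'δ'}. Then the function t ↦ ∫_{ℝ^4} L[h + t k](x) dx is differentiable at t = 0 with derivative ∫_{ℝ^4} ℬ^{αβ}[h](x) k_{αβ}(x) dx. -/

import Mathlib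

noncomputable section

open MeasureTheory

/-- Minkowski metric `diag(-1,1,…,1)` on `Fin n`. -/
def eta (n : ℕ) (μ ν : Fin n) : ℝ :=
  if μ = ν then (if (μ : ℕ) = 0 then -1 else 1) else 0

/-- Partial derivative in the coordinate direction `μ`. -/
def pd {n : ℕ} (μ : Fin n) (f : (Fin n → ℝ) → ℝ) : (Fin n → ℝ) → ℝ :=
  fun x => fderiv ℝ f x (Pi.single μ 1)

/-- A rank-2 covariant field on `ℝ^n`. -/
abbrev TensorField (n : ℕ) := Fin n → Fin n → (Fin n → ℝ) → ℝ

/-- Linearized Riemann tensor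
`ℛ_{αβγδ}[h] = −(1/2)(∂_α∂_γ h_{βδ} + ∂_β∂_δ h_{αγ} − ∂_α∂_δ h_{βγ} − ∂_β∂_γ h_{αδ})`. -/
def Riem {n : ℕ} (h : TensorField n) (α β γ δ : Fin n) : (Fin n → ℝ) → ℝ :=
  fun x => -(1/2) * (pd α (pd γ (h β δ)) x + pd β (pd δ (h α γ)) x
    - pd α (pd δ (h β γ)) x - pd β (pd γ (h α δ)) x)

/-- Linearized Ricci tensor
`ℛ_{μν}[h] = (1/2) η^{αλ}(∂_μ∂_α h_{λν} − ∂_λ∂_α h_{μν} − ∂_μ∂_ν h_{λα} + ∂_λ∂_ν h_{μα})`. -/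
def Ricci {n : ℕ} (h : TensorField n) (μ ν : Fin n) : (Fin n → ℝ) → ℝ :=
  fun x => (1/2) * ∑ α, ∑ l, eta n α l *
    (pd μ (pd α (h l ν)) x - pd l (pd α (h μ ν)) x
      - pd μ (pd ν (h l α)) x + pd l (pd ν (h μ α)) x)

/-- Linearized scalar curvature `ℛ[h] = η^{αλ}η^{μν}(∂_λ∂_ν h_{μα} − ∂_α∂_λ h_{μν})`. -/
def Scal {n : ℕ} (h : TensorField n) : (Fin n → ℝ) → ℝ :=
  fun x => ∑ α, ∑ l, ∑ μ, ∑ ν, eta n α l * eta n μ ν *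
    (pd l (pd ν (h μ α)) x - pd α (pd l (h μ ν)) x)

/-- Linearized Schouten-type tensor
`𝒦_{μν}[h] = (1/(n−2))(ℛ_{μν}[h] − η_{μν}ℛ[h]/(2(n−1)))`. -/
def Kt {n : ℕ} (h : TensorField n) (μ ν : Fin n) : (Fin n → ℝ) → ℝ :=
  fun x => (1 / ((n : ℝ) - 2)) *
    (Ricci h μ ν x - eta n μ ν * Scal h x / (2 * ((n : ℝ) - 1)))

/-- Linearized Weyl tensor
`𝒲_{αβγδ}[h] = ℛ_{αβγδ}[h] − η_{αγ}𝒦_{δβ}[h] + η_{αδ}𝒦_{γβ}[h] + η_{βγ}𝒦_{δα}[h] − η_{βδ}𝒦_{γα}[h]`. -/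
def Weyl {n : ℕ} (h : TensorField n) (α β γ δ : Fin n) : (Fin n → ℝ) → ℝ :=
  fun x => Riem h α β γ δ x - eta n α γ * Kt h δ β x + eta n α δ * Kt h γ β x
    + eta n β γ * Kt h δ α x - eta n β δ * Kt h γ α x

/-- Linearized Cotton tensor `𝒞_{αβμ}[h] = ∂_μ𝒦_{βα}[h] − ∂_β𝒦_{μα}[h]`. -/
def Cotton {n : ℕ} (h : TensorField n) (α β μ : Fin n) : (Fin n → ℝ) → ℝ :=
  fun x => pd μ (Kt h β α) x - pd β (Kt h μ α) x

/-- Cotton tensor with all indices raised: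
`𝒞^{αβρ}[h] = η^{αα'}η^{ββ'}η^{ρρ'}𝒞_{α'β'ρ'}[h]`. -/
def CottonUp {n : ℕ} (h : TensorField n) (α β ρ : Fin n) : (Fin n → ℝ) → ℝ :=
  fun x => ∑ α', ∑ β', ∑ ρ', eta n α α' * eta n β β' * eta n ρ ρ' * Cotton h α' β' ρ' x

/-- Linearized Bach tensor `ℬ^{αβ}[h] = −2∂_ρ𝒞^{αβρ}[h]`. -/
def Bach {n : ℕ} (h : TensorField n) (α β : Fin n) : (Fin n → ℝ) → ℝ :=
  fun x => -2 * ∑ ρ, pd ρ (CottonUp h α β ρ) x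

/-- Linearized Weyl tensor with all indices raised. -/
def WeylUp (h : TensorField 4) (α β γ δ : Fin 4) : (Fin 4 → ℝ) → ℝ :=
  fun x => ∑ α', ∑ β', ∑ γ', ∑ δ', eta 4 α α' * eta 4 β β' * eta 4 γ γ' * eta 4 δ δ' *
    Weyl h α' β' γ' δ' x

/-- Free linearized Weyl Lagrangian density `L[h] = (1/2) 𝒲_{αβγδ}[h] 𝒲^{αβγδ}[h]`. -/
def Lag (h : TensorField 4) : (Fin 4 → ℝ) → ℝ :=
  fun x => (1/2) * ∑ α, ∑ β, ∑ γ, ∑ δ, Weyl h α β γ δ x * WeylUp h α β γ δ x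

/-- Values of the second derivatives `∂_a ∂_b h_{mn}` at a point, indexed by `(a, b, m, n)`. -/
abbrev Jet (n : ℕ) := Fin n × Fin n × Fin n × Fin n → ℝ

/-- The second derivatives of a tensor field at a point. -/
def jet {n : ℕ} (h : TensorField n) (x : Fin n → ℝ) : Jet n :=
  fun i => pd i.1 (pd i.2.1 (h i.2.2.1 i.2.2.2)) x

/-- The coordinate functional `∂_a ∂_b h_{mn}` on jets. -/
def jetCoord {n : ℕ} (a b m k : Fin n) : Jet n →ₗ[ℝ] ℝ := LinearMap.proj (a, b, m, k)

@[simp] lemma jetCoord_apply {n : ℕ} (a b m k : Fin n) (Q : Jet n) :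
    jetCoord a b m k Q = Q (a, b, m, k) := rfl

/-- The linearized Riemann tensor as a functional on jets. -/
def riemL {n : ℕ} (α β γ δ : Fin n) : Jet n →ₗ[ℝ] ℝ :=
  (-(1 / 2) : ℝ) • (jetCoord α γ β δ + jetCoord β δ α γ - jetCoord α δ β γ - jetCoord β γ α δ)

/-- The linearized Ricci tensor as a functional on jets. -/
def ricciL {n : ℕ} (μ ν : Fin n) : Jet n →ₗ[ℝ] ℝ :=
  (1 / 2 : ℝ) • ∑ α, ∑ l, eta n α l •
    (jetCoord μ α l ν - jetCoord l α μ ν - jetCoord μ ν l α + jetCoord l ν μ α)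

/-- The linearized scalar curvature as a functional on jets. -/
def scalL {n : ℕ} : Jet n →ₗ[ℝ] ℝ :=
  ∑ α, ∑ l, ∑ μ, ∑ ν, (eta n α l * eta n μ ν) • (jetCoord l ν μ α - jetCoord α l μ ν)

/-- The linearized Schouten-type tensor as a functional on jets. -/
def ktL {n : ℕ} (μ ν : Fin n) : Jet n →ₗ[ℝ] ℝ :=
  (1 / ((n : ℝ) - 2)) • (ricciL μ ν - (eta n μ ν / (2 * ((n : ℝ) - 1))) • scalL)

/-- The linearized Weyl tensor as a functional on jets. -/
def weylL {n : ℕ} (α β γ δ : Fin n) : Jet n →ₗ[ℝ] ℝ :=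
  riemL α β γ δ - eta n α γ • ktL δ β + eta n α δ • ktL γ β
    + eta n β γ • ktL δ α - eta n β δ • ktL γ α

lemma kt_eq {n : ℕ} (h : TensorField n) (μ ν : Fin n) :
    Kt h μ ν = fun x => ktL μ ν (jet h x) := by
  funext x
  have hR : Ricci h μ ν x = ricciL μ ν (jet h x) := by
    simp only [Ricci, ricciL, jet, LinearMap.sum_apply, LinearMap.smul_apply, LinearMap.sub_apply,
      LinearMap.add_apply, jetCoord_apply, smul_eq_mul]
  have hS : Scal h x = scalL (jet h x) := by
    simp [Scal, scalL, jet, LinearMap.sum_apply]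
  simp only [Kt, ktL, hR, hS, LinearMap.smul_apply, LinearMap.sub_apply, smul_eq_mul]
  ring

lemma weyl_eq {n : ℕ} (h : TensorField n) (α β γ δ : Fin n) :
    Weyl h α β γ δ = fun x => weylL α β γ δ (jet h x) := by
  funext x
  have hR : Riem h α β γ δ x = riemL α β γ δ (jet h x) := by
    simp [Riem, riemL, jet]
  simp [Weyl, weylL, hR, kt_eq]

/-! ### Contractions with the Minkowski metric -/

lemma eta_comm {n : ℕ} (μ ν : Fin n) : eta n μ ν = eta n ν μ := by
  unfold eta
  by_cases hμν : μ = ν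
  · subst hμν; rfl
  · simp [hμν, Ne.symm hμν]

lemma eta_of_ne {n : ℕ} {μ ν : Fin n} (hμν : μ ≠ ν) : eta n μ ν = 0 := by
  simp [eta, hμν]

lemma eta_self_mul_self {n : ℕ} (μ : Fin n) : eta n μ μ * eta n μ μ = 1 := by
  rw [eta, if_pos rfl]
  split_ifs <;> norm_num

lemma sum_eta_mul {n : ℕ} (μ : Fin n) (f : Fin n → ℝ) :
    ∑ ν, eta n μ ν * f ν = eta n μ μ * f μ :=
  Finset.sum_eq_single μ (fun ν _ hν => by rw [eta_of_ne hν.symm, zero_mul]) (by simp)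

lemma sum_eta_self_mul_eta {n : ℕ} (μ : Fin n) (f : Fin n → ℝ) :
    ∑ ν, eta n ν ν * (eta n ν μ * f ν) = f μ := by
  rw [Finset.sum_eq_single μ (fun ν _ hν => by rw [eta_of_ne hν]; ring) (by simp),
    ← mul_assoc, eta_self_mul_self, one_mul]

lemma ricciL_apply {n : ℕ} (μ ν : Fin n) (Q : Jet n) :
    ricciL μ ν Q = (1 / 2) * ∑ α, eta n α α *
      (Q (μ, α, α, ν) - Q (α, α, μ, ν) - Q (μ, ν, α, α) + Q (α, ν, μ, α)) := by
  simp only [ricciL, LinearMap.sum_apply, LinearMap.smul_apply, LinearMap.sub_apply,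
    LinearMap.add_apply, jetCoord_apply, smul_eq_mul, sum_eta_mul]

lemma scalL_apply {n : ℕ} (Q : Jet n) :
    scalL Q = ∑ α, ∑ μ, eta n α α * eta n μ μ * (Q (α, μ, μ, α) - Q (α, α, μ, μ)) := by
  simp only [scalL, LinearMap.sum_apply, LinearMap.smul_apply, LinearMap.sub_apply,
    jetCoord_apply, smul_eq_mul, mul_assoc, ← Finset.mul_sum, sum_eta_mul]

lemma ktL_apply {n : ℕ} (μ ν : Fin n) (Q : Jet n) :
    ktL μ ν Q = (1 / ((n : ℝ) - 2)) *
      (ricciL μ ν Q - (eta n μ ν / (2 * ((n : ℝ) - 1))) * scalL Q) := rfl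

lemma riemL_apply {n : ℕ} (α β γ δ : Fin n) (Q : Jet n) :
    riemL α β γ δ Q =
      -(1 / 2) * (Q (α, γ, β, δ) + Q (β, δ, α, γ) - Q (α, δ, β, γ) - Q (β, γ, α, δ)) := rfl

lemma weylL_apply {n : ℕ} (α β γ δ : Fin n) (Q : Jet n) :
    weylL α β γ δ Q = riemL α β γ δ Q - eta n α γ * ktL δ β Q + eta n α δ * ktL γ β Q
      + eta n β γ * ktL δ α Q - eta n β δ * ktL γ α Q := rfl

lemma weylL_swap_left {n : ℕ} (α β γ δ : Fin n) (Q : Jet n) :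
    weylL β α γ δ Q = -weylL α β γ δ Q := by
  simp only [weylL_apply, riemL_apply]; ring

lemma weylL_swap_right {n : ℕ} (α β γ δ : Fin n) (Q : Jet n) :
    weylL α β δ γ Q = -weylL α β γ δ Q := by
  simp only [weylL_apply, riemL_apply]; ring

/-- The symmetries of the second derivatives of a symmetric tensor field. -/
structure Jet.IsSymm {n : ℕ} (Q : Jet n) : Prop where
  deriv : ∀ a b m k, Q (a, b, m, k) = Q (b, a, m, k)
  tensor : ∀ a b m k, Q (a, b, m, k) = Q (a, b, k, m)

lemma Jet.IsSymm.ricciL_comm {n : ℕ} {Q : Jet n} (hQ : Q.IsSymm) (μ ν : Fin n) :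
    ricciL μ ν Q = ricciL ν μ Q := by
  simp only [ricciL_apply]
  congr 1
  refine Finset.sum_congr rfl fun α _ => ?_
  rw [hQ.deriv μ α, hQ.tensor α μ, hQ.tensor α α μ, hQ.deriv μ ν, hQ.deriv α ν, hQ.tensor ν α μ]
  ring

lemma Jet.IsSymm.ktL_comm {n : ℕ} {Q : Jet n} (hQ : Q.IsSymm) (μ ν : Fin n) :
    ktL μ ν Q = ktL ν μ Q := by
  simp only [ktL_apply, hQ.ricciL_comm μ ν, eta_comm μ ν]

lemma Jet.IsSymm.sum_ricciL {n : ℕ} {Q : Jet n} (hQ : Q.IsSymm) :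
    ∑ μ, eta n μ μ * ricciL μ μ Q = scalL Q := by
  have hswap : ∑ μ, ∑ α, eta n μ μ * eta n α α * Q (μ, μ, α, α) =
      ∑ μ, ∑ α, eta n μ μ * eta n α α * Q (α, α, μ, μ) := by
    rw [Finset.sum_comm]
    simp only [mul_comm]
  have hterm : ∀ μ α, eta n μ μ * (1 / 2 * (eta n α α * (Q (μ, α, α, μ) - Q (α, α, μ, μ) -
      Q (μ, μ, α, α) + Q (α, μ, μ, α)))) =
      eta n μ μ * eta n α α * Q (μ, α, α, μ)
      - (1 / 2) * (eta n μ μ * eta n α α * Q (μ, μ, α, α))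
      - (1 / 2) * (eta n μ μ * eta n α α * Q (α, α, μ, μ)) := fun μ α => by
    rw [hQ.deriv α μ, hQ.tensor μ α μ α]; ring
  simp only [ricciL_apply, scalL_apply, Finset.mul_sum, hterm, mul_sub, Finset.sum_sub_distrib]
  simp only [← Finset.mul_sum, ← hswap]
  ring

lemma Jet.IsSymm.sum_riemL {n : ℕ} {Q : Jet n} (hQ : Q.IsSymm) (β δ : Fin n) :
    ∑ α, eta n α α * riemL α β α δ Q = ricciL β δ Q := by
  simp only [ricciL_apply, riemL_apply, Finset.mul_sum]
  refine Finset.sum_congr rfl fun α _ => ?_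
  rw [hQ.deriv β α, hQ.tensor α δ β α]
  ring

lemma Jet.IsSymm.sum_ktL {Q : Jet 4} (hQ : Q.IsSymm) :
    ∑ μ, eta 4 μ μ * ktL μ μ Q = scalL Q / 6 := by
  have hterm : ∀ μ, eta 4 μ μ * ktL μ μ Q =
      (1 / 2) * (eta 4 μ μ * ricciL μ μ Q) - scalL Q / 12 := fun μ => by
    rw [ktL_apply]
    push_cast
    linear_combination (-scalL Q / 12) * eta_self_mul_self μ
  simp only [hterm, Finset.sum_sub_distrib, ← Finset.mul_sum, hQ.sum_ricciL]
  simp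
  ring

lemma Jet.IsSymm.sum_weylL {Q : Jet 4} (hQ : Q.IsSymm) (β δ : Fin 4) :
    ∑ α, eta 4 α α * weylL α β α δ Q = 0 := by
  have hterm : ∀ α, eta 4 α α * weylL α β α δ Q = eta 4 α α * riemL α β α δ Q - ktL δ β Q
      + eta 4 α α * (eta 4 α δ * ktL α β Q) + eta 4 α α * (eta 4 α β * ktL δ α Q)
      - eta 4 β δ * (eta 4 α α * ktL α α Q) := fun α => by
    rw [weylL_apply, eta_comm β α]
    linear_combination (-ktL δ β Q) * eta_self_mul_self α
  simp only [hterm, Finset.sum_sub_distrib, Finset.sum_add_distrib, sum_eta_self_mul_eta,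
    ← Finset.mul_sum, hQ.sum_riemL, hQ.sum_ktL]
  rw [ktL_apply, hQ.ricciL_comm β δ, eta_comm δ β]
  simp
  ring

/-- Contracting an antisymmetric trace-free `w` with the Weyl tensor only sees the leading term
of the Riemann tensor. -/
lemma sum_mul_weylL {n : ℕ} (w : Fin n → Fin n → Fin n → Fin n → ℝ)
    (hleft : ∀ α β γ δ, w β α γ δ = -w α β γ δ) (hright : ∀ α β γ δ, w α β δ γ = -w α β γ δ)
    (htrace : ∀ β δ, ∑ α, eta n α α * w α β α δ = 0) (Q : Jet n) :
    ∑ α, ∑ β, ∑ γ, ∑ δ,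
      eta n α α * eta n β β * eta n γ γ * eta n δ δ * (w α β γ δ * weylL α β γ δ Q) =
    -2 * ∑ α, ∑ β, ∑ γ, ∑ δ,
      eta n α α * eta n β β * eta n γ γ * eta n δ δ * (w α β γ δ * Q (α, γ, β, δ)) := by
  let v : Fin n → Fin n → Fin n → Fin n → ℝ := fun α β γ δ =>
    eta n α α * eta n β β * eta n γ γ * eta n δ δ * w α β γ δ
  let A : Fin n → Fin n → Fin n → Fin n → ℝ := fun α β γ δ =>
    -(1 / 2) * Q (α, γ, β, δ) - eta n α γ * ktL δ β Q
  have vleft : ∀ α β γ δ, v β α γ δ = -v α β γ δ := fun α β γ δ => by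
    simp only [v, hleft α β]; ring
  have vright : ∀ α β γ δ, v α β δ γ = -v α β γ δ := fun α β γ δ => by
    simp only [v, hright α β γ]; ring
  have h1 : ∑ α, ∑ β, ∑ γ, ∑ δ, v α β γ δ * A β α γ δ =
      -∑ α, ∑ β, ∑ γ, ∑ δ, v α β γ δ * A α β γ δ := by
    rw [Finset.sum_comm]
    simp only [← Finset.sum_neg_distrib]
    refine Finset.sum_congr rfl fun α _ => Finset.sum_congr rfl fun β _ =>
      Finset.sum_congr rfl fun γ _ => Finset.sum_congr rfl fun δ _ => ?_
    rw [vleft, neg_mul]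
  have h2 : ∀ B : Fin n → Fin n → Fin n → Fin n → ℝ,
      ∑ α, ∑ β, ∑ γ, ∑ δ, v α β γ δ * B α β δ γ =
      -∑ α, ∑ β, ∑ γ, ∑ δ, v α β γ δ * B α β γ δ := fun B => by
    simp only [← Finset.sum_neg_distrib]
    refine Finset.sum_congr rfl fun α _ => Finset.sum_congr rfl fun β _ => ?_
    rw [Finset.sum_comm]
    refine Finset.sum_congr rfl fun γ _ => Finset.sum_congr rfl fun δ _ => ?_
    rw [vright, neg_mul]
  have h3 := h2 A
  have h4 := h2 fun α β γ δ => A β α γ δ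
  have hK : ∑ α, ∑ β, ∑ γ, ∑ δ, v α β γ δ * (eta n α γ * ktL δ β Q) = 0 := by
    have hterm : ∀ α β δ, ∑ γ, v α β γ δ * (eta n α γ * ktL δ β Q) =
        eta n β β * eta n δ δ * ktL δ β Q * (eta n α α * w α β α δ) := fun α β δ => by
      have := sum_eta_mul α fun γ => v α β γ δ * ktL δ β Q
      simp only [v] at this ⊢
      calc _ = _ := Finset.sum_congr rfl fun γ _ => by ring
        _ = _ := this
        _ = _ := by
          linear_combination (eta n α α * eta n β β * eta n δ δ * w α β α δ * ktL δ β Q) *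
            eta_self_mul_self α
    rw [Finset.sum_comm]
    refine Finset.sum_eq_zero fun β _ => ?_
    rw [Finset.sum_congr rfl fun α _ => Finset.sum_comm, Finset.sum_comm]
    refine Finset.sum_eq_zero fun δ _ => ?_
    rw [Finset.sum_congr rfl fun α _ => hterm α β δ, ← Finset.mul_sum, htrace, mul_zero]
  have hA : ∑ α, ∑ β, ∑ γ, ∑ δ, v α β γ δ * A α β γ δ =
      -(1 / 2) * ∑ α, ∑ β, ∑ γ, ∑ δ, v α β γ δ * Q (α, γ, β, δ) := by
    rw [← sub_zero (-(1 / 2) * _), ← hK]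
    simp only [Finset.mul_sum, ← Finset.sum_sub_distrib]
    simp only [A]
    refine Finset.sum_congr rfl fun α _ => Finset.sum_congr rfl fun β _ =>
      Finset.sum_congr rfl fun γ _ => Finset.sum_congr rfl fun δ _ => by ring
  have hW : ∀ α β γ δ, eta n α α * eta n β β * eta n γ γ * eta n δ δ *
      (w α β γ δ * weylL α β γ δ Q) = v α β γ δ * A α β γ δ - v α β γ δ * A β α γ δ
      - v α β γ δ * A α β δ γ + v α β γ δ * A β α δ γ := fun α β γ δ => by
    simp only [v, A, weylL_apply, riemL_apply]; ring
  simp only [hW, Finset.sum_sub_distrib, Finset.sum_add_distrib, h3, h4, h1, hA]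
  simp only [v, ← mul_assoc]
  ring

/-! ### Divergences -/

/-- The symmetries of the third derivatives `∂_c ∂_a ∂_b h_{mn}` of a symmetric tensor field. -/
structure IsSymmThirdJet {n : ℕ} (D : Fin n → Jet n) : Prop where
  symm : ∀ c, (D c).IsSymm
  swap : ∀ c a b m k, D c (a, b, m, k) = D a (c, b, m, k)

namespace IsSymmThirdJet

variable {n : ℕ} {D : Fin n → Jet n}

lemma swap' (hD : IsSymmThirdJet D) (c a b m k : Fin n) :
    D c (a, b, m, k) = D b (a, c, m, k) := by
  rw [(hD.symm c).deriv, hD.swap, (hD.symm b).deriv]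

/-- The contracted second Bianchi identity for the Riemann tensor. -/
lemma sum_riemL (hD : IsSymmThirdJet D) (β γ δ : Fin n) :
    ∑ α, eta n α α * riemL α β γ δ (D α) = ricciL β δ (D γ) - ricciL β γ (D δ) := by
  simp only [ricciL_apply, riemL_apply, Finset.mul_sum, ← Finset.sum_sub_distrib]
  refine Finset.sum_congr rfl fun α _ => ?_
  rw [hD.swap α β δ, hD.swap α β γ, hD.swap' α α γ, hD.swap' α α δ, hD.swap' γ β δ,
    hD.swap' γ α δ, hD.swap' β α δ, hD.swap' β α γ, (hD.symm γ).deriv β α, (hD.symm δ).deriv β α]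
  ring

/-- The contracted second Bianchi identity for the Ricci tensor. -/
lemma sum_ricciL (hD : IsSymmThirdJet D) (δ : Fin n) :
    ∑ α, eta n α α * ricciL δ α (D α) = (1 / 2) * scalL (D δ) := by
  have hterm : ∀ α l, eta n α α * (1 / 2 * (eta n l l * (D α (δ, l, l, α) - D α (l, l, δ, α)
      - D α (δ, α, l, l) + D α (l, α, δ, l)))) =
      (1 / 2) * (eta n α α * eta n l l * (D δ (α, l, l, α) - D δ (α, α, l, l)))
      - (1 / 2) * (eta n α α * eta n l l * D α (l, l, δ, α))
      + (1 / 2) * (eta n α α * eta n l l * D l (α, α, δ, l)) := fun α l => by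
    rw [hD.swap α δ l, hD.swap α δ α, hD.swap α l α]; ring
  have hswap : ∑ α, ∑ l, eta n α α * eta n l l * D l (α, α, δ, l) =
      ∑ α, ∑ l, eta n α α * eta n l l * D α (l, l, δ, α) := by
    rw [Finset.sum_comm]
    refine Finset.sum_congr rfl fun α _ => Finset.sum_congr rfl fun l _ => by ring
  simp only [ricciL_apply, scalL_apply, Finset.mul_sum (Finset.univ : Finset (Fin n)), hterm,
    Finset.sum_add_distrib, Finset.sum_sub_distrib]
  simp only [← Finset.mul_sum, hswap]
  ring

lemma sum_ktL {D : Fin 4 → Jet 4} (hD : IsSymmThirdJet D) (δ : Fin 4) :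
    ∑ α, eta 4 α α * ktL δ α (D α) = scalL (D δ) / 6 := by
  have hterm : ∀ α, eta 4 α α * ktL δ α (D α) = (1 / 2) * (eta 4 α α * ricciL δ α (D α))
      - (1 / 12) * (eta 4 α α * (eta 4 α δ * scalL (D α))) := fun α => by
    rw [ktL_apply, eta_comm δ α]
    push_cast
    ring
  simp only [hterm, Finset.sum_sub_distrib, ← Finset.mul_sum, hD.sum_ricciL, sum_eta_self_mul_eta]
  ring

/-- The divergence of the Weyl tensor is the Cotton tensor. -/
lemma sum_weylL {D : Fin 4 → Jet 4} (hD : IsSymmThirdJet D) (β γ δ : Fin 4) :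
    ∑ α, eta 4 α α * weylL α β γ δ (D α) = ktL δ β (D γ) - ktL γ β (D δ) := by
  have hterm : ∀ α, eta 4 α α * weylL α β γ δ (D α) = eta 4 α α * riemL α β γ δ (D α)
      - eta 4 α α * (eta 4 α γ * ktL δ β (D α)) + eta 4 α α * (eta 4 α δ * ktL γ β (D α))
      + eta 4 β γ * (eta 4 α α * ktL δ α (D α))
      - eta 4 β δ * (eta 4 α α * ktL γ α (D α)) := fun α => by
    rw [weylL_apply]; ring
  simp only [hterm, Finset.sum_sub_distrib, Finset.sum_add_distrib, sum_eta_self_mul_eta,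
    ← Finset.mul_sum, hD.sum_riemL, hD.sum_ktL]
  rw [ktL_apply, ktL_apply, (hD.symm γ).ricciL_comm β δ, (hD.symm δ).ricciL_comm β γ,
    eta_comm δ β, eta_comm γ β]
  push_cast
  ring

end IsSymmThirdJet

/-! ### Smooth functions and their derivatives -/

section Smooth

variable {n : ℕ} {f g : (Fin n → ℝ) → ℝ} {h k : TensorField n}

lemma ContDiff.pd (hf : ContDiff ℝ (⊤ : ℕ∞) f) (μ : Fin n) : ContDiff ℝ (⊤ : ℕ∞) (pd μ f) :=
  (hf.fderiv_right (m := (⊤ : ℕ∞)) (by simp)).clm_apply contDiff_const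

lemma HasCompactSupport.pd (hf : HasCompactSupport f) (μ : Fin n) : HasCompactSupport (pd μ f) :=
  hf.fderiv_apply ℝ _

lemma pd_comm (hf : ContDiff ℝ (⊤ : ℕ∞) f) (μ ν : Fin n) : pd μ (pd ν f) = pd ν (pd μ f) := by
  have key : ∀ (x : Fin n → ℝ) (α β : Fin n),
      pd α (pd β f) x = fderiv ℝ (fderiv ℝ f) x (Pi.single α 1) (Pi.single β 1) := fun x α β => by
    have hd : DifferentiableAt ℝ (fderiv ℝ f) x :=
      (hf.fderiv_right (m := (⊤ : ℕ∞)) (by simp)).differentiable (by simp) x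
    unfold pd
    rw [fderiv_clm_apply hd (differentiableAt_const _)]
    simp
  funext x
  rw [key, key]
  have htwo : (2 : WithTop ℕ∞) ≤ (⊤ : ℕ∞) := WithTop.coe_le_coe.2 le_top
  exact hf.contDiffAt.isSymmSndFDerivAt (by simpa using htwo) _ _

lemma pd_add_const_mul (hf : ContDiff ℝ (⊤ : ℕ∞) f) (hg : ContDiff ℝ (⊤ : ℕ∞) g) (t : ℝ)
    (μ : Fin n) : pd μ (fun x => f x + t * g x) = fun x => pd μ f x + t * pd μ g x := by
  funext x
  have hf' := hf.differentiable (by simp) x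
  have hg' := hg.differentiable (by simp) x
  simp only [pd]
  rw [fderiv_fun_add hf' (hg'.const_mul t), fderiv_const_mul hg']
  simp

lemma pd_const_mul (hf : ContDiff ℝ (⊤ : ℕ∞) f) (c : ℝ) (μ : Fin n) :
    pd μ (fun x => c * f x) = fun x => c * pd μ f x := by
  funext x
  simp only [pd]
  rw [fderiv_const_mul (hf.differentiable (by simp) x)]
  simp

lemma pd_sum {ι : Type*} {s : Finset ι} {F : ι → (Fin n → ℝ) → ℝ}
    (hF : ∀ i ∈ s, ContDiff ℝ (⊤ : ℕ∞) (F i)) (μ : Fin n) :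
    pd μ (fun x => ∑ i ∈ s, F i x) = fun x => ∑ i ∈ s, pd μ (F i) x := by
  funext x
  simp only [pd]
  rw [fderiv_fun_sum fun i hi => (hF i hi).differentiable (by simp) x]
  simp

lemma LinearMap.jet_apply_eq_sum (L : Jet n →ₗ[ℝ] ℝ) (Q : Jet n) :
    L Q = ∑ i, L (Pi.single i 1) * Q i := by
  rw [L.pi_apply_eq_sum_univ Q]
  refine Finset.sum_congr rfl fun i _ => ?_
  rw [smul_eq_mul, mul_comm]
  congr 2
  ext j
  simp [Pi.single_apply, eq_comm]

lemma contDiff_jet (hh : ∀ μ ν, ContDiff ℝ (⊤ : ℕ∞) (h μ ν)) (i) :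
    ContDiff ℝ (⊤ : ℕ∞) fun x => jet h x i :=
  ((hh _ _).pd _).pd _

lemma contDiff_linearMap_jet (hh : ∀ μ ν, ContDiff ℝ (⊤ : ℕ∞) (h μ ν)) (L : Jet n →ₗ[ℝ] ℝ) :
    ContDiff ℝ (⊤ : ℕ∞) fun x => L (jet h x) :=
  L.toContinuousLinearMap.contDiff.comp (contDiff_pi.2 (contDiff_jet hh))

lemma hasCompactSupport_linearMap_jet (hh : ∀ μ ν, HasCompactSupport (h μ ν))
    (L : Jet n →ₗ[ℝ] ℝ) : HasCompactSupport fun x => L (jet h x) := by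
  have hsupp : ∀ i, HasCompactSupport fun x => jet h x i := fun i => ((hh _ _).pd _).pd _
  have hcompact : IsCompact (⋃ i, tsupport fun x => jet h x i) :=
    isCompact_iUnion fun i => hsupp i
  refine HasCompactSupport.intro hcompact fun x hx => ?_
  rw [Set.mem_iUnion, not_exists] at hx
  have hzero : jet h x = 0 := 
    funext fun i => image_eq_zero_of_notMem_tsupport (f := fun x => jet h x i) (hx i)
  rw [hzero, map_zero]

lemma pd_linearMap_jet (hh : ∀ μ ν, ContDiff ℝ (⊤ : ℕ∞) (h μ ν)) (L : Jet n →ₗ[ℝ] ℝ)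
    (μ : Fin n) :
    pd μ (fun x => L (jet h x)) = fun x => L fun i => pd μ (fun y => jet h y i) x := by
  have hterm := fun i => contDiff_jet hh i
  rw [funext fun x => L.jet_apply_eq_sum (jet h x), pd_sum fun i _ => contDiff_const.mul (hterm i)]
  funext x
  rw [L.jet_apply_eq_sum]
  simp only [pd_const_mul (hterm _)]

lemma jet_add_const_mul (hh : ∀ μ ν, ContDiff ℝ (⊤ : ℕ∞) (h μ ν))
    (hk : ∀ μ ν, ContDiff ℝ (⊤ : ℕ∞) (k μ ν)) (t : ℝ) (x : Fin n → ℝ) :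
    jet (fun μ ν y => h μ ν y + t * k μ ν y) x = jet h x + t • jet k x := by
  funext i
  simp only [jet, pd_add_const_mul (hh _ _) (hk _ _),
    pd_add_const_mul ((hh _ _).pd _) ((hk _ _).pd _), Pi.add_apply, Pi.smul_apply, smul_eq_mul]

lemma jet_isSymm (hh : ∀ μ ν, ContDiff ℝ (⊤ : ℕ∞) (h μ ν)) (hsym : ∀ μ ν, h μ ν = h ν μ)
    (x : Fin n → ℝ) : (jet h x).IsSymm where
  deriv a b m k := by simp only [jet, pd_comm (hh m k) a b]
  tensor a b m k := by simp only [jet, hsym m k]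

lemma isSymmThirdJet_pd_jet (hh : ∀ μ ν, ContDiff ℝ (⊤ : ℕ∞) (h μ ν))
    (hsym : ∀ μ ν, h μ ν = h ν μ) (x : Fin n → ℝ) :
    IsSymmThirdJet fun c i => pd c (fun y => jet h y i) x where
  symm c :=
    { deriv := fun a b m k => by simp only [jet, pd_comm (hh m k) a b]
      tensor := fun a b m k => by simp only [jet, hsym m k] }
  swap c a b m k := congrFun (pd_comm ((hh m k).pd b) c a) x

lemma integrable_mul (hf : ContDiff ℝ (⊤ : ℕ∞) f) (hg : ContDiff ℝ (⊤ : ℕ∞) g)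
    (hgs : HasCompactSupport g) : Integrable fun x => f x * g x :=
  (hf.continuous.mul hg.continuous).integrable_of_hasCompactSupport hgs.mul_left

lemma integral_sum_four {F : Fin n → Fin n → Fin n → Fin n → (Fin n → ℝ) → ℝ}
    (hF : ∀ α β γ δ, Integrable (F α β γ δ)) :
    ∫ x, ∑ α, ∑ β, ∑ γ, ∑ δ, F α β γ δ x = ∑ α, ∑ β, ∑ γ, ∑ δ, ∫ x, F α β γ δ x := by
  have h1 := fun α β γ => integrable_finsetSum Finset.univ fun δ _ => hF α β γ δ
  have h2 := fun α β => integrable_finsetSum Finset.univ fun γ _ => h1 α β γ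
  have h3 := fun α => integrable_finsetSum Finset.univ fun β _ => h2 α β
  rw [integral_finsetSum _ fun α _ => h3 α]
  refine Finset.sum_congr rfl fun α _ => ?_
  rw [integral_finsetSum _ fun β _ => h2 α β]
  refine Finset.sum_congr rfl fun β _ => ?_
  rw [integral_finsetSum _ fun γ _ => h1 α β γ]
  exact Finset.sum_congr rfl fun γ _ => integral_finsetSum _ fun δ _ => hF α β γ δ

lemma integral_mul_pd (hf : ContDiff ℝ (⊤ : ℕ∞) f) (hg : ContDiff ℝ (⊤ : ℕ∞) g)
    (hgs : HasCompactSupport g) (μ : Fin n) :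
    ∫ x, f x * pd μ g x = -∫ x, pd μ f x * g x :=
  integral_mul_fderiv_eq_neg_fderiv_mul_of_integrable (integrable_mul (hf.pd μ) hg hgs)
    (integrable_mul hf (hg.pd μ) (hgs.pd μ)) (integrable_mul hf hg hgs)
    (fun x _ => hf.differentiable (by simp) x) (fun x _ => hg.differentiable (by simp) x)

lemma integral_mul_pd_pd (hf : ContDiff ℝ (⊤ : ℕ∞) f) (hg : ContDiff ℝ (⊤ : ℕ∞) g)
    (hgs : HasCompactSupport g) (μ ν : Fin n) :
    ∫ x, f x * pd μ (pd ν g) x = ∫ x, pd ν (pd μ f) x * g x := by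
  rw [integral_mul_pd hf (hg.pd ν) (hgs.pd ν), integral_mul_pd (hf.pd μ) hg hgs, neg_neg]

end Smooth

/-! ### Weyl and Bach tensors -/

section Weyl

variable {n : ℕ} {h k : TensorField n}

lemma contDiff_weyl (hh : ∀ μ ν, ContDiff ℝ (⊤ : ℕ∞) (h μ ν)) (α β γ δ : Fin n) :
    ContDiff ℝ (⊤ : ℕ∞) (Weyl h α β γ δ) := by
  rw [weyl_eq]
  exact contDiff_linearMap_jet hh _

lemma hasCompactSupport_weyl (hh : ∀ μ ν, HasCompactSupport (h μ ν)) (α β γ δ : Fin n) :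
    HasCompactSupport (Weyl h α β γ δ) := by
  rw [weyl_eq]
  exact hasCompactSupport_linearMap_jet hh _

lemma weyl_add_const_mul (hh : ∀ μ ν, ContDiff ℝ (⊤ : ℕ∞) (h μ ν))
    (hk : ∀ μ ν, ContDiff ℝ (⊤ : ℕ∞) (k μ ν)) (t : ℝ) (α β γ δ : Fin n) (x : Fin n → ℝ) :
    Weyl (fun μ ν y => h μ ν y + t * k μ ν y) α β γ δ x =
      Weyl h α β γ δ x + t * Weyl k α β γ δ x := by
  simp only [weyl_eq, jet_add_const_mul hh hk, map_add, map_smul, smul_eq_mul]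

end Weyl

lemma cotton_eq_sum_pd_weyl {h : TensorField 4} (hh : ∀ μ ν, ContDiff ℝ (⊤ : ℕ∞) (h μ ν))
    (hsym : ∀ μ ν, h μ ν = h ν μ) (β δ γ : Fin 4) :
    Cotton h β δ γ = fun x => ∑ α, eta 4 α α * pd α (Weyl h α β γ δ) x := by
  funext x
  simp only [Cotton, weyl_eq, kt_eq, pd_linearMap_jet hh]
  exact ((isSymmThirdJet_pd_jet hh hsym x).sum_weylL β γ δ).symm

lemma bach_eq_sum_pd_pd_weyl {h : TensorField 4} (hh : ∀ μ ν, ContDiff ℝ (⊤ : ℕ∞) (h μ ν))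
    (hsym : ∀ μ ν, h μ ν = h ν μ) (β δ : Fin 4) (x : Fin 4 → ℝ) :
    Bach h β δ x = -2 * ∑ γ, ∑ α, eta 4 α α * eta 4 β β * eta 4 γ γ * eta 4 δ δ *
      pd γ (pd α (Weyl h α β γ δ)) x := by
  have hup : ∀ γ, CottonUp h β δ γ = fun x => ∑ α, eta 4 α α * eta 4 β β * eta 4 γ γ *
      eta 4 δ δ * pd α (Weyl h α β γ δ) x := fun γ => by
    funext x
    simp only [CottonUp, mul_assoc, ← Finset.mul_sum, sum_eta_mul, cotton_eq_sum_pd_weyl hh hsym]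
    simp only [Finset.mul_sum]
    refine Finset.sum_congr rfl fun α _ => by ring
  have hW := fun α γ => (contDiff_weyl hh α β γ δ).pd α
  simp only [Bach, hup]
  congr 1
  refine Finset.sum_congr rfl fun γ _ => ?_
  rw [pd_sum fun α _ => contDiff_const.mul (hW α γ)]
  simp only [pd_const_mul (hW _ _)]

/-- The pairing `𝒲_{αβγδ}[h] 𝒲^{αβγδ}[k]`. -/
def weylPairing (h k : TensorField 4) (x : Fin 4 → ℝ) : ℝ :=
  ∑ α, ∑ β, ∑ γ, ∑ δ, eta 4 α α * eta 4 β β * eta 4 γ γ * eta 4 δ δ *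
    (Weyl h α β γ δ x * Weyl k α β γ δ x)

lemma lag_eq_weylPairing (h : TensorField 4) (x : Fin 4 → ℝ) :
    Lag h x = (1 / 2) * weylPairing h h x := by
  simp only [Lag, WeylUp, weylPairing, mul_assoc, ← Finset.mul_sum, sum_eta_mul]
  simp only [mul_left_comm (Weyl h _ _ _ _ x), Finset.mul_sum]

section Pairing

variable {h k : TensorField 4}

lemma lag_add_const_mul (hh : ∀ μ ν, ContDiff ℝ (⊤ : ℕ∞) (h μ ν))
    (hk : ∀ μ ν, ContDiff ℝ (⊤ : ℕ∞) (k μ ν)) (t : ℝ) (x : Fin 4 → ℝ) :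
    Lag (fun μ ν y => h μ ν y + t * k μ ν y) x =
      (1 / 2) * weylPairing h h x + t * weylPairing h k x
        + t ^ 2 * ((1 / 2) * weylPairing k k x) := by
  rw [lag_eq_weylPairing]
  simp only [weylPairing, weyl_add_const_mul hh hk, Finset.mul_sum, ← Finset.sum_add_distrib]
  refine Finset.sum_congr rfl fun α _ => Finset.sum_congr rfl fun β _ =>
    Finset.sum_congr rfl fun γ _ => Finset.sum_congr rfl fun δ _ => by ring

lemma integrable_weylPairing (hh : ∀ μ ν, ContDiff ℝ (⊤ : ℕ∞) (h μ ν))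
    (hk : ∀ μ ν, ContDiff ℝ (⊤ : ℕ∞) (k μ ν)) (hks : ∀ μ ν, HasCompactSupport (k μ ν)) :
    Integrable (weylPairing h k) :=
  integrable_finsetSum _ fun α _ => integrable_finsetSum _ fun β _ =>
    integrable_finsetSum _ fun γ _ => integrable_finsetSum _ fun δ _ =>
      (integrable_mul (contDiff_weyl hh α β γ δ) (contDiff_weyl hk α β γ δ)
        (hasCompactSupport_weyl hks α β γ δ)).const_mul _

lemma weylPairing_eq (hh : ∀ μ ν, ContDiff ℝ (⊤ : ℕ∞) (h μ ν)) (hsym : ∀ μ ν, h μ ν = h ν μ)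
    (x : Fin 4 → ℝ) :
    weylPairing h k x = -2 * ∑ α, ∑ β, ∑ γ, ∑ δ, eta 4 α α * eta 4 β β * eta 4 γ γ * eta 4 δ δ *
      (Weyl h α β γ δ x * pd α (pd γ (k β δ)) x) := by
  simp only [weylPairing, weyl_eq]
  exact sum_mul_weylL (fun α β γ δ => weylL α β γ δ (jet h x))
    (fun α β γ δ => weylL_swap_left α β γ δ _) (fun α β γ δ => weylL_swap_right α β γ δ _)
    (fun β δ => (jet_isSymm hh hsym x).sum_weylL β δ) (jet k x)

/-- Integrating by parts twice moves the Weyl pairing onto the Bach tensor. -/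
lemma integral_weylPairing (hh : ∀ μ ν, ContDiff ℝ (⊤ : ℕ∞) (h μ ν))
    (hsym : ∀ μ ν, h μ ν = h ν μ) (hk : ∀ μ ν, ContDiff ℝ (⊤ : ℕ∞) (k μ ν))
    (hks : ∀ μ ν, HasCompactSupport (k μ ν)) :
    ∫ x, weylPairing h k x = ∫ x, ∑ β, ∑ δ, Bach h β δ x * k β δ x := by
  have hW := fun α β γ δ => contDiff_weyl hh α β γ δ
  have hint : ∀ α β γ δ, Integrable fun x => eta 4 α α * eta 4 β β * eta 4 γ γ * eta 4 δ δ *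
      (Weyl h α β γ δ x * pd α (pd γ (k β δ)) x) := fun α β γ δ =>
    (integrable_mul (hW α β γ δ) (((hk β δ).pd γ).pd α) (((hks β δ).pd γ).pd α)).const_mul _
  have hint' : ∀ α β γ δ, Integrable fun x => eta 4 α α * eta 4 β β * eta 4 γ γ * eta 4 δ δ *
      (pd γ (pd α (Weyl h α β γ δ)) x * k β δ x) := fun α β γ δ =>
    (integrable_mul (((hW α β γ δ).pd α).pd γ) (hk β δ) (hks β δ)).const_mul _
  have hBach : ∀ x, ∑ β, ∑ δ, Bach h β δ x * k β δ x = -2 * ∑ α, ∑ β, ∑ γ, ∑ δ,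
      eta 4 α α * eta 4 β β * eta 4 γ γ * eta 4 δ δ *
        (pd γ (pd α (Weyl h α β γ δ)) x * k β δ x) := fun x => by
    simp only [bach_eq_sum_pd_pd_weyl hh hsym, Finset.mul_sum, Finset.sum_mul]
    symm
    rw [Finset.sum_comm]
    refine Finset.sum_congr rfl fun β _ => ?_
    rw [Finset.sum_comm, Finset.sum_congr rfl fun γ _ => Finset.sum_comm, Finset.sum_comm]
    refine Finset.sum_congr rfl fun δ _ => Finset.sum_congr rfl fun γ _ =>
      Finset.sum_congr rfl fun α _ => by ring
  simp only [weylPairing_eq hh hsym, hBach, integral_const_mul, integral_sum_four hint,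
    integral_sum_four hint', integral_mul_pd_pd (hW _ _ _ _) (hk _ _) (hks _ _)]

end Pairing

/-- the Euler–Lagrange derivative of the free linearized Weyl Lagrangian
`L[h] = (1/2) 𝒲_{αβγδ}[h] 𝒲^{αβγδ}[h]` is the linearized Bach tensor. -/
theorem euler_lagrange_of_weyl_lagrangian_is_bach
    (h k : TensorField 4)
    (hsmooth : ∀ μ ν, ContDiff ℝ (⊤ : ℕ∞) (h μ ν))
    (hsupp : ∀ μ ν, HasCompactSupport (h μ ν))
    (hsym : ∀ μ ν, h μ ν = h ν μ)
    (ksmooth : ∀ μ ν, ContDiff ℝ (⊤ : ℕ∞) (k μ ν))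
    (ksupp : ∀ μ ν, HasCompactSupport (k μ ν))
    (ksym : ∀ μ ν, k μ ν = k ν μ) :
    HasDerivAt
      (fun t : ℝ => ∫ x : Fin 4 → ℝ, Lag (fun μ ν y => h μ ν y + t * k μ ν y) x)
      (∫ x : Fin 4 → ℝ, ∑ α, ∑ β, Bach h α β x * k α β x) 0 := by
  have hLag : ∀ t : ℝ, ∫ x : Fin 4 → ℝ, Lag (fun μ ν y => h μ ν y + t * k μ ν y) x =
      (∫ x, 1 / 2 * weylPairing h h x) + t * (∫ x, weylPairing h k x)
        + t ^ 2 * ∫ x, 1 / 2 * weylPairing k k x := fun t => by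
    have hhh := (integrable_weylPairing hsmooth hsmooth hsupp).const_mul (1 / 2)
    have hhk := (integrable_weylPairing hsmooth ksmooth ksupp).const_mul t
    have hkk := ((integrable_weylPairing ksmooth ksmooth ksupp).const_mul (1 / 2)).const_mul (t ^ 2)
    have hsum : Integrable fun x => 1 / 2 * weylPairing h h x + t * weylPairing h k x :=
      hhh.add hhk
    simp only [lag_add_const_mul hsmooth ksmooth]
    rw [integral_add hsum hkk, integral_add hhh hhk, integral_const_mul t,
      integral_const_mul (t ^ 2)]
  simp only [hLag, ← integral_weylPairing hsmooth hsym ksmooth ksupp]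
  have hid := hasDerivAt_id (0 : ℝ)
  simpa using ((hid.mul_const (∫ x, weylPairing h k x)).const_add _).fun_add
    ((hid.pow 2).mul_const (∫ x, 1 / 2 * weylPairing k k x))
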